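/- Let G be a 1-ended group. Let q : Perm(G) → S⋆(G) be the canonical homomorphism sending a permutation of G to its class in the near symmetric group, and let λ, ρ : G → Perm(G) be the left and right regular representations, λ_g(x) = gx and ρ_g(x) = xg⁻¹. Then the centralizer of q(λ(G)) in S⋆(G) is exactly q(ρ(G)), and q ∘ ρ is injective; hence q ∘ ρ is an isomorphism of G onto the centralizer in S⋆(G) of the image of the left regular representation. -/

import Mathlib

open Set

universe u v w

variable {X : Type u}

/-- A cofinite-partial bijection of `X`: a partial bijection whose source and target
are cofinite subsets of `X`. -/
def IsCofinBij (e : PartialEquiv X X) : Prop :=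
  e.sourceᶜ.Finite ∧ e.targetᶜ.Finite

/-- The set where two partial bijections are both defined and agree. -/
def nearAgree (e e' : PartialEquiv X X) : Set X :=
  {x | x ∈ e.source ∧ x ∈ e'.source ∧ e x = e' x}

theorem mem_nearAgree {e e' : PartialEquiv X X} {x : X} :
    x ∈ nearAgree e e' ↔ x ∈ e.source ∧ x ∈ e'.source ∧ e x = e' x := Iff.rfl

/-- Two partial bijections coincide on a cofinite set (where both are defined). -/
def NearEqv (e e' : PartialEquiv X X) : Prop := (nearAgree e e')ᶜ.Finite

theorem isCofinBij_refl : IsCofinBij (PartialEquiv.refl X) := by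
  constructor
  · rw [PartialEquiv.refl_source, compl_univ]; exact finite_empty
  · rw [PartialEquiv.refl_target, compl_univ]; exact finite_empty

theorem IsCofinBij.symm {e : PartialEquiv X X} (h : IsCofinBij e) : IsCofinBij e.symm := by
  constructor
  · rw [PartialEquiv.symm_source]; exact h.2
  · rw [PartialEquiv.symm_target]; exact h.1

theorem trans_source_compl_finite {e e' : PartialEquiv X X}
    (h : e.sourceᶜ.Finite) (h' : e'.sourceᶜ.Finite) : (e.trans e').sourceᶜ.Finite := by
  have hsub : (e.trans e').sourceᶜ ⊆ e.sourceᶜ ∪ (e.source ∩ ⇑e ⁻¹' e'.sourceᶜ) := by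
    intro x hx
    by_cases hxe : x ∈ e.source
    · refine mem_union_right _ (mem_inter hxe ?_)
      rw [mem_preimage, mem_compl_iff]
      intro hmem
      exact hx (by rw [PartialEquiv.trans_source]; exact ⟨hxe, hmem⟩)
    · exact mem_union_left _ hxe
  refine Set.Finite.subset (h.union ?_) hsub
  refine Set.Finite.of_finite_image (Set.Finite.subset h' ?_) (e.injOn.mono inter_subset_left)
  rintro y ⟨x, ⟨_, hxp⟩, rfl⟩
  exact hxp

theorem IsCofinBij.trans {e e' : PartialEquiv X X} (h : IsCofinBij e) (h' : IsCofinBij e') :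
    IsCofinBij (e.trans e') := by
  refine ⟨trans_source_compl_finite h.1 h'.1, ?_⟩
  have key : (e.trans e').target = (e'.symm.trans e.symm).source := by
    rw [PartialEquiv.trans_target, PartialEquiv.trans_source, PartialEquiv.symm_source,
      PartialEquiv.symm_source]
  rw [key]
  refine trans_source_compl_finite ?_ ?_
  · rw [PartialEquiv.symm_source]; exact h'.2
  · rw [PartialEquiv.symm_source]; exact h.2

theorem nearEqv_refl_of {e : PartialEquiv X X} (h : e.sourceᶜ.Finite) : NearEqv e e := by
  refine Set.Finite.subset h fun x hx => ?_
  rw [mem_compl_iff] at hx ⊢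
  intro hs
  exact hx (mem_nearAgree.mpr ⟨hs, hs, rfl⟩)

theorem NearEqv.symm {e e' : PartialEquiv X X} (h : NearEqv e e') : NearEqv e' e := by
  refine Set.Finite.subset h fun x hx => ?_
  rw [mem_compl_iff] at hx ⊢
  intro hs
  obtain ⟨h1, h2, h3⟩ := mem_nearAgree.mp hs
  exact hx (mem_nearAgree.mpr ⟨h2, h1, h3.symm⟩)

theorem NearEqv.trans {e₁ e₂ e₃ : PartialEquiv X X}
    (h12 : NearEqv e₁ e₂) (h23 : NearEqv e₂ e₃) : NearEqv e₁ e₃ := by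
  refine Set.Finite.subset (h12.union h23) fun x hx => ?_
  rw [mem_compl_iff] at hx
  rw [mem_union, mem_compl_iff, mem_compl_iff]
  by_contra hc
  push_neg at hc
  obtain ⟨ha, hb⟩ := hc
  obtain ⟨ha1, ha2, ha3⟩ := mem_nearAgree.mp ha
  obtain ⟨hb1, hb2, hb3⟩ := mem_nearAgree.mp hb
  exact hx (mem_nearAgree.mpr ⟨ha1, hb2, ha3.trans hb3⟩)

instance nearSetoid (X : Type u) : Setoid { e : PartialEquiv X X // IsCofinBij e } where
  r a b := NearEqv a.1 b.1
  iseqv := by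
    constructor
    · intro a; exact nearEqv_refl_of a.2.1
    · intro a b h; exact h.symm
    · intro a b c h h'; exact h.trans h'

/-- The near symmetric group of `X`: bijections between cofinite subsets of `X`, two of
them being identified when they coincide on a cofinite subset. -/
def NearPerm (X : Type u) : Type u := Quotient (nearSetoid X)

/-- The class in `NearPerm X` of a cofinite-partial bijection; i.e. `e` is a
representative of `NearPerm.mk e he`. -/
def NearPerm.mk (e : PartialEquiv X X) (he : IsCofinBij e) : NearPerm X :=
  Quotient.mk (nearSetoid X) ⟨e, he⟩

theorem nearEqv_trans_congr {a a' b b' : PartialEquiv X X}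
    (haa : NearEqv a a') (hbb : NearEqv b b') :
    NearEqv (b.trans a) (b'.trans a') := by
  have hfin2 : (b.source ∩ ⇑b ⁻¹' (nearAgree a a')ᶜ).Finite := by
    refine Set.Finite.of_finite_image (Set.Finite.subset haa ?_)
      (b.injOn.mono inter_subset_left)
    rintro y ⟨x, ⟨_, hxp⟩, rfl⟩
    exact hxp
  refine Set.Finite.subset (hbb.union hfin2) fun x hx => ?_
  rw [mem_compl_iff] at hx
  by_cases hA : x ∈ nearAgree b b'
  · obtain ⟨hb1, hb2, hb3⟩ := mem_nearAgree.mp hA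
    refine mem_union_right _ (mem_inter hb1 ?_)
    rw [mem_preimage, mem_compl_iff]
    intro hB
    obtain ⟨ha1, ha2, ha3⟩ := mem_nearAgree.mp hB
    refine hx (mem_nearAgree.mpr ⟨?_, ?_, ?_⟩)
    · rw [PartialEquiv.trans_source]; exact ⟨hb1, ha1⟩
    · rw [PartialEquiv.trans_source]
      refine ⟨hb2, ?_⟩
      rw [mem_preimage, ← hb3]
      exact ha2
    · rw [PartialEquiv.trans_apply, PartialEquiv.trans_apply, ← hb3, ha3]
  · exact mem_union_left _ hA

theorem nearEqv_symm_congr {e e' : PartialEquiv X X} (he : IsCofinBij e)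
    (h : NearEqv e e') : NearEqv e.symm e'.symm := by
  have h1 : (⇑e '' nearAgree e e')ᶜ.Finite := by
    have hsub : (⇑e '' nearAgree e e')ᶜ ⊆
        e.targetᶜ ∪ (e.target ∩ ⇑e.symm ⁻¹' (nearAgree e e')ᶜ) := by
      intro y hy
      by_cases hyt : y ∈ e.target
      · refine mem_union_right _ (mem_inter hyt ?_)
        rw [mem_preimage, mem_compl_iff]
        intro hmem
        rw [mem_compl_iff] at hy
        exact hy ⟨e.symm y, hmem, e.right_inv hyt⟩
      · exact mem_union_left _ hyt
    refine Set.Finite.subset (Set.Finite.union he.2 ?_) hsub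
    refine Set.Finite.of_finite_image (f := ⇑e.symm) (Set.Finite.subset h ?_) ?_
    · rintro z ⟨y, ⟨_, hyp⟩, rfl⟩
      exact hyp
    · refine e.symm.injOn.mono ?_
      rw [PartialEquiv.symm_source]
      exact inter_subset_left
  refine Set.Finite.subset h1 (compl_subset_compl.mpr ?_)
  rintro y ⟨x, hx, rfl⟩
  obtain ⟨hx1, hx2, hx3⟩ := mem_nearAgree.mp hx
  refine mem_nearAgree.mpr ⟨?_, ?_, ?_⟩
  · rw [PartialEquiv.symm_source]; exact e.map_source hx1
  · rw [PartialEquiv.symm_source, hx3]; exact e'.map_source hx2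
  · rw [e.left_inv hx1, hx3, e'.left_inv hx2]

instance : Group (NearPerm X) where
  mul f g :=
    Quotient.liftOn₂ f g
      (fun a b => Quotient.mk (nearSetoid X) ⟨b.1.trans a.1, b.2.trans a.2⟩)
      (fun _ _ _ _ ha hb => Quotient.sound (nearEqv_trans_congr ha hb))
  one := Quotient.mk (nearSetoid X) ⟨PartialEquiv.refl X, isCofinBij_refl⟩
  inv f :=
    Quotient.map (fun a => ⟨a.1.symm, a.2.symm⟩)
      (fun a _ h => nearEqv_symm_congr a.2 h) f
  mul_assoc f g h := by
    refine Quotient.inductionOn₃ f g h fun a b c => ?_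
    exact congrArg (Quotient.mk _) (Subtype.ext (PartialEquiv.trans_assoc _ _ _).symm)
  one_mul f := by
    refine Quotient.inductionOn f fun a => ?_
    exact congrArg (Quotient.mk _) (Subtype.ext (PartialEquiv.trans_refl _))
  mul_one f := by
    refine Quotient.inductionOn f fun a => ?_
    exact congrArg (Quotient.mk _) (Subtype.ext (PartialEquiv.refl_trans _))
  inv_mul_cancel f := by
    refine Quotient.inductionOn f fun a => ?_
    apply Quotient.sound
    show NearEqv (a.1.trans a.1.symm) (PartialEquiv.refl X)
    refine Set.Finite.subset a.2.1 (compl_subset_compl.mpr ?_)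
    intro x hx
    refine mem_nearAgree.mpr ⟨?_, ?_, ?_⟩
    · rw [PartialEquiv.trans_source]
      refine ⟨hx, ?_⟩
      rw [mem_preimage, PartialEquiv.symm_source]
      exact a.1.map_source hx
    · rw [PartialEquiv.refl_source]; exact mem_univ x
    · rw [PartialEquiv.trans_apply, a.1.left_inv hx, PartialEquiv.refl_coe, id_eq]

theorem isCofinBij_toPartialEquiv (σ : Equiv.Perm X) : IsCofinBij σ.toPartialEquiv := by
  constructor
  · show (Set.univ : Set X)ᶜ.Finite
    rw [compl_univ]; exact finite_empty
  · show (Set.univ : Set X)ᶜ.Finite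
    rw [compl_univ]; exact finite_empty

/-- The canonical homomorphism from the symmetric group of `X` to the near symmetric
group of `X`. -/
def permToNear (X : Type u) : Equiv.Perm X →* NearPerm X where
  toFun σ := NearPerm.mk σ.toPartialEquiv (isCofinBij_toPartialEquiv σ)
  map_one' := by
    apply Quotient.sound
    show NearEqv _ _
    refine Set.Finite.subset finite_empty fun x hx => absurd (mem_nearAgree.mpr ?_) hx
    exact ⟨mem_univ x, mem_univ x, rfl⟩
  map_mul' σ τ := by
    apply Quotient.sound
    show NearEqv _ _
    refine Set.Finite.subset finite_empty fun x hx => absurd (mem_nearAgree.mpr ?_) hx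
    refine ⟨mem_univ x, ⟨mem_univ x, mem_univ (τ x)⟩, rfl⟩

/-- A group is 1-ended if it is infinite and every subset `A` such that `gA Δ A` is
finite for every `g` is finite or cofinite. -/
def OneEnded (G : Type v) [Group G] : Prop :=
  Infinite G ∧
    ∀ A : Set G, (∀ g : G, (symmDiff ((g * ·) '' A) A).Finite) → A.Finite ∨ Aᶜ.Finite

/-- The left regular representation `λ` of `G`, `λ_g x = g * x`. -/
def leftRegular (G : Type v) [Group G] : G →* Equiv.Perm G :=
  MulAction.toPermHom G G

/-- The right regular representation `ρ` of `G`, `ρ_g x = x * g⁻¹`. -/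
def rightRegular (G : Type v) [Group G] : G →* Equiv.Perm G where
  toFun g := Equiv.mulRight g⁻¹
  map_one' := by ext x; simp
  map_mul' g h := by ext x; simp [mul_assoc]

theorem Set.Infinite.exists_infinite_subset_infinite_diff {β : Type*} {s : Set β}
    (hs : s.Infinite) : ∃ t ⊆ s, t.Infinite ∧ (s \ t).Infinite := by
  let φ := hs.natEmbedding
  have hφ : ∀ {m n : ℕ}, (φ m : β) = φ n → m = n := fun h => φ.injective (Subtype.ext h)
  refine ⟨Set.range fun n => (φ (2 * n) : β), ?_, ?_, ?_⟩
  · rintro _ ⟨n, rfl⟩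
    exact (φ (2 * n)).2
  · refine Set.infinite_range_of_injective fun m n h => ?_
    have := hφ h
    omega
  · have hodd : (Set.range fun n => (φ (2 * n + 1) : β)).Infinite := by
      refine Set.infinite_range_of_injective fun m n h => ?_
      have := hφ h
      omega
    refine hodd.mono ?_
    rintro _ ⟨n, rfl⟩
    refine ⟨(φ (2 * n + 1)).2, ?_⟩
    rintro ⟨m, h⟩
    have := hφ h
    omega

/-- On a 1-ended group, a map which is nearly invariant under left translations is constant
outside a finite set. -/
theorem OneEnded.exists_finite_ne {G : Type*} [Group G] (hG : OneEnded G) {β : Type*}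
    (c : G → β) (hc : ∀ g : G, {x | c (g * x) ≠ c x}.Finite) :
    ∃ b, {x | c x ≠ b}.Finite := by
  have hB : ∀ B : Set β, (c ⁻¹' B).Finite ∨ (c ⁻¹' B)ᶜ.Finite := by
    refine fun B => hG.2 _ fun g => (hc g⁻¹).subset ?_
    intro y hy hcy
    simp only [Set.mem_symmDiff, Set.image_mul_left, Set.mem_preimage, hcy] at hy
    tauto
  by_contra! hne
  have hfib : ∀ b, (c ⁻¹' {b}).Finite := fun b => (hB {b}).resolve_right (hne b)
  have : Infinite G := hG.1
  have hrange : (Set.range c).Infinite := by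
    intro hfin
    refine Set.infinite_univ (α := G) ?_
    rw [← Set.preimage_range c]
    exact hfin.preimage' fun b _ => hfib b
  obtain ⟨B, hBc, hBinf, hdiff⟩ := hrange.exists_infinite_subset_infinite_diff
  rcases hB B with h | h
  · exact hBinf.preimage hBc h
  · refine hdiff.preimage Set.sdiff_subset (h.subset ?_)
    exact fun x hx => hx.2

theorem NearPerm.mk_eq_mk {e e' : PartialEquiv X X} {he : IsCofinBij e} {he' : IsCofinBij e'} :
    NearPerm.mk e he = NearPerm.mk e' he' ↔ NearEqv e e' :=
  Quotient.eq (r := nearSetoid X)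

theorem NearPerm.mk_eq_permToNear {e : PartialEquiv X X} {he : IsCofinBij e}
    {σ : Equiv.Perm X} :
    NearPerm.mk e he = permToNear X σ ↔ {x | e x ≠ σ x}.Finite := by
  refine NearPerm.mk_eq_mk.trans ⟨fun h => h.subset fun x hx hx' => hx hx'.2.2, fun h => ?_⟩
  refine (he.1.union h).subset fun x hx => ?_
  by_contra hcon
  simp only [Set.mem_union, Set.mem_compl_iff, Set.mem_ofPred_eq, not_or, not_not] at hcon
  exact hx ⟨hcon.1, Set.mem_univ x, hcon.2⟩

theorem permToNear_eq_iff {σ τ : Equiv.Perm X} :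
    permToNear X σ = permToNear X τ ↔ {x | σ x ≠ τ x}.Finite :=
  NearPerm.mk_eq_permToNear (he := isCofinBij_toPartialEquiv σ)

/-- If the class of `e` commutes with that of a permutation `σ`, then `e` nearly commutes
with `σ`. -/
theorem NearPerm.finite_ne_of_commute {e : PartialEquiv X X} {he : IsCofinBij e}
    {σ : Equiv.Perm X}
    (h : permToNear X σ * NearPerm.mk e he = NearPerm.mk e he * permToNear X σ) :
    {x | e (σ x) ≠ σ (e x)}.Finite :=
  (NearPerm.mk_eq_mk.mp h).subset fun _ hx hx' => hx hx'.2.2.symm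

theorem commute_leftRegular_rightRegular {G : Type*} [Group G] (g h : G) :
    Commute (leftRegular G g) (rightRegular G h) :=
  Equiv.ext fun x => (mul_assoc g x h⁻¹).symm

theorem permToNear_comp_rightRegular_injective (G : Type*) [Group G] [Infinite G] :
    Function.Injective ((permToNear G).comp (rightRegular G)) := by
  intro g h hgh
  by_contra hne
  refine Set.infinite_univ (α := G) ((permToNear_eq_iff.mp hgh).subset fun x _ hx => hne ?_)
  exact inv_injective (mul_left_cancel hx)

/-- For a 1-ended group `G`, the centralizer in the near symmetric group `S⋆(G)` of the
image of the left regular representation is precisely the image of the right regular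
representation, and the latter maps `G` injectively; hence `G` is isomorphic, via
`q ∘ ρ`, to this centralizer. -/
theorem centralizer_of_left_regular_eq_right_regular
    {G : Type u} [Group G] (hG : OneEnded G) :
    Subgroup.centralizer ((((permToNear G).comp (leftRegular G)).range : Subgroup (NearPerm G)) : Set (NearPerm G)) =
        ((permToNear G).comp (rightRegular G)).range ∧
      Function.Injective ((permToNear G).comp (rightRegular G)) := by
  have := hG.1
  refine ⟨le_antisymm ?_ ?_, permToNear_comp_rightRegular_injective G⟩
  · intro f hf
    induction f using Quotient.inductionOn with | _ a => ?_
    obtain ⟨e, he⟩ := a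
    change NearPerm.mk e he ∈ _ at hf
    change NearPerm.mk e he ∈ _
    rw [Subgroup.mem_centralizer_iff] at hf
    obtain ⟨b, hb⟩ := hG.exists_finite_ne (fun x => x⁻¹ * e x) fun g => by
      refine (NearPerm.finite_ne_of_commute (hf _ ⟨g, rfl⟩)).subset fun x hx hx' => hx ?_
      change e (g * x) = g * e x at hx'
      simp [hx', mul_assoc]
    refine ⟨b⁻¹, (NearPerm.mk_eq_permToNear.mpr (hb.subset fun x hx hx' => hx ?_)).symm⟩
    change e x = x * b⁻¹⁻¹
    rw [inv_inv, ← hx', mul_inv_cancel_left]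
  · rintro _ ⟨h, rfl⟩
    rw [Subgroup.mem_centralizer_iff]
    rintro _ ⟨g, rfl⟩
    exact (commute_leftRegular_rightRegular g h).map (permToNear G)
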